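/- arXiv:2104.03484 — 2 statements merged into one kernel-verified Lean document; each statement's English description precedes it below -/
import Mathlib

section
/- For every integer t ≥ 2, every finite metric space X with weight function w: X → ℝ⁺ contains a subspace S ⊆ X such that S embeds into an ultrametric space with distortion at most 8t, and Σ_{x∈S} w(x)^{1-1/t} ≥ (Σ_{x∈X} w(x))^{1-1/t}. -/
open Finset

/-- A distance function is an ultrametric. -/
def IsUltrametric {U : Type*} (ρ : U → U → ℝ) : Prop :=
  (∀ x y, 0 ≤ ρ x y) ∧ (∀ x y, ρ x y = 0 ↔ x = y) ∧ (∀ x y, ρ x y = ρ y x) ∧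
    (∀ x y z, ρ x z ≤ max (ρ x y) (ρ y z))

theorem aux_pigeon (t : ℕ) (ht : 0 < t) (a : ℕ → ℝ) (m m' : ℝ) (hm : 0 < m) (hm' : 0 < m')
    (h0 : a 0 = m' ^ t) (h1 : a t ≤ m ^ t) :
    ∃ i, i < t ∧ a (i + 1) * m' ≤ m * a i := by
  by_contra! hcon
  have key : ∀ k, k ≤ t → m ^ k * a 0 ≤ a k * m' ^ k ∧ (0 < k → m ^ k * a 0 < a k * m' ^ k) := by
    intro k
    induction k with
    | zero => intro _; simp
    | succ k ih =>
      intro hk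
      have h2 := hcon k (by omega)
      have h3 := (ih (by omega)).1
      have hpk : 0 < m' ^ k := by positivity
      have : m ^ (k + 1) * a 0 < a (k + 1) * m' ^ (k + 1) := by
        calc m ^ (k + 1) * a 0 = m * (m ^ k * a 0) := by ring
          _ ≤ m * (a k * m' ^ k) := by gcongr
          _ = (m * a k) * m' ^ k := by ring
          _ < (a (k + 1) * m') * m' ^ k := by gcongr
          _ = a (k + 1) * m' ^ (k + 1) := by ring
      exact ⟨this.le, fun _ => this⟩
  have h2 := (key t le_rfl).2 ht
  rw [h0] at h2
  have hpk : 0 < m' ^ t := by positivity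
  have := lt_of_mul_lt_mul_right h2 hpk.le
  linarith

/-- `ρ` restricted to `S` is an ultrametric of diameter at most `D`, between `dist` and `8t·dist`. -/
structure GoodU {X : Type*} [MetricSpace X] (t : ℕ) (S : Finset X) (ρ : X → X → ℝ) (D : ℝ) :
    Prop where
  lo : ∀ x ∈ S, ∀ y ∈ S, dist x y ≤ ρ x y
  hi : ∀ x ∈ S, ∀ y ∈ S, ρ x y ≤ 8 * t * dist x y
  sym : ∀ x ∈ S, ∀ y ∈ S, ρ x y = ρ y x
  ultra : ∀ x ∈ S, ∀ y ∈ S, ∀ z ∈ S, ρ x z ≤ max (ρ x y) (ρ y z)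
  bd : ∀ x ∈ S, ∀ y ∈ S, ρ x y ≤ D

theorem aux_glue {X : Type*} [MetricSpace X] [DecidableEq X] (t : ℕ) (S₁ S₂ : Finset X)
    (ρ₁ ρ₂ : X → X → ℝ) (D : ℝ)
    (h₁ : GoodU t S₁ ρ₁ D) (h₂ : GoodU t S₂ ρ₂ D)
    (hD : ∀ x ∈ S₁, ∀ y ∈ S₂, dist x y ≤ D)
    (hs : ∀ x ∈ S₁, ∀ y ∈ S₂, D ≤ 8 * t * dist x y) (hdis : Disjoint S₁ S₂) (hD0 : 0 ≤ D) :
    ∃ ρ, GoodU t (S₁ ∪ S₂) ρ D := by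
  have hdis' : ∀ x, x ∈ S₂ → x ∉ S₁ := fun x hx hx1 => (Finset.disjoint_left.1 hdis hx1) hx
  refine ⟨fun x y => if x ∈ S₁ then (if y ∈ S₁ then ρ₁ x y else D)
    else (if y ∈ S₁ then D else ρ₂ x y), ?_, ?_, ?_, ?_, ?_⟩
  · intro x hx y hy
    rcases Finset.mem_union.1 hx with hx | hx <;> rcases Finset.mem_union.1 hy with hy | hy
    · simpa [hx, hy] using h₁.lo x hx y hy
    · simpa [hx, hdis' y hy] using hD x hx y hy
    · simpa [hy, hdis' x hx, dist_comm] using hD y hy x hx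
    · simpa [hdis' x hx, hdis' y hy] using h₂.lo x hx y hy
  · intro x hx y hy
    rcases Finset.mem_union.1 hx with hx | hx <;> rcases Finset.mem_union.1 hy with hy | hy
    · simpa [hx, hy] using h₁.hi x hx y hy
    · simpa [hx, hdis' y hy] using hs x hx y hy
    · simpa [hy, hdis' x hx, dist_comm] using hs y hy x hx
    · simpa [hdis' x hx, hdis' y hy] using h₂.hi x hx y hy
  · intro x hx y hy
    rcases Finset.mem_union.1 hx with hx | hx <;> rcases Finset.mem_union.1 hy with hy | hy
    · simpa [hx, hy] using h₁.sym x hx y hy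
    · simp [hx, hdis' y hy]
    · simp [hy, hdis' x hx]
    · simpa [hdis' x hx, hdis' y hy] using h₂.sym x hx y hy
  · intro x hx y hy z hz
    rcases Finset.mem_union.1 hx with hx | hx <;> rcases Finset.mem_union.1 hy with hy | hy <;>
      rcases Finset.mem_union.1 hz with hz | hz
    · simpa [hx, hy, hz] using h₁.ultra x hx y hy z hz
    · simp [hx, hy, hdis' z hz]
    · simpa [hx, hz, hdis' y hy] using h₁.bd x hx z hz
    · simp [hx, hdis' y hy, hdis' z hz]
    · simp [hy, hz, hdis' x hx]
    · simpa [hy, hdis' x hx, hdis' z hz] using h₂.bd x hx z hz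
    · simp [hz, hdis' x hx, hdis' y hy]
    · simpa [hdis' x hx, hdis' y hy, hdis' z hz] using h₂.ultra x hx y hy z hz
  · intro x hx y hy
    rcases Finset.mem_union.1 hx with hx | hx <;> rcases Finset.mem_union.1 hy with hy | hy
    · simpa [hx, hy] using h₁.bd x hx y hy
    · simp [hx, hdis' y hy]
    · simp [hy, hdis' x hx]
    · simpa [hdis' x hx, hdis' y hy] using h₂.bd x hx y hy

theorem aux_main {X : Type*} [MetricSpace X] [DecidableEq X] (t : ℕ) (ht : 2 ≤ t)
    (w : X → ℝ) (hw : ∀ x, 0 < w x) (n : ℕ) :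
    ∀ (Z : Finset X), Z.card ≤ n → ∀ (Δ m : ℝ), 0 ≤ Δ → 0 < m →
      (∀ x ∈ Z, ∀ y ∈ Z, dist x y ≤ Δ) →
      (∀ x ∈ Z, ∑ y ∈ Z with dist x y ≤ Δ / 4, w y ≤ m ^ t) →
      ∃ S ⊆ Z, ∃ ρ, GoodU t S ρ Δ ∧
        (∑ x ∈ Z, w x) / m ≤ ∑ x ∈ S, w x ^ (1 - 1 / (t : ℝ)) := by
  have ht0 : (0 : ℝ) < t := by exact_mod_cast (by omega : 0 < t)
  induction n with
  | zero =>
    intro Z hZ Δ m hΔ hm hd hM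
    have : Z = ∅ := by simpa using hZ
    subst this
    exact ⟨∅, le_rfl, fun _ _ => 0, ⟨by simp, by simp, by simp, by simp, by simp⟩, by simp⟩
  | succ n ih =>
    intro Z hZ Δ m hΔ hm hd hM
    by_cases hsub : ∀ x ∈ Z, ∀ y ∈ Z, x = y
    · refine ⟨Z, le_rfl, fun _ _ => 0, ⟨?_, ?_, by simp, by simp, fun _ _ _ _ => hΔ⟩, ?_⟩
      · intro x hx y hy; simp [hsub x hx y hy]
      · intro x hx y hy; simp [hsub x hx y hy]
      · rw [Finset.sum_div]
        refine Finset.sum_le_sum fun x hx => ?_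
        have h1 : w x ≤ m ^ t := by
          refine le_trans ?_ (hM x hx)
          refine Finset.single_le_sum (f := w) (fun i _ => (hw i).le) ?_
          simp [hx]; positivity
        have h2 : w x ^ (1 / (t : ℝ)) ≤ m := by
          calc w x ^ (1 / (t : ℝ)) ≤ (m ^ t) ^ (1 / (t : ℝ)) :=
                Real.rpow_le_rpow (hw x).le h1 (by positivity)
            _ = m := by rw [one_div]; exact Real.pow_rpow_inv_natCast hm.le (by omega)
        rw [Real.rpow_sub (hw x), Real.rpow_one]
        exact div_le_div_of_nonneg_left (hw x).le (Real.rpow_pos_of_pos (hw x) _) h2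
    push Not at hsub
    obtain ⟨p, hp, q, hq, hpq⟩ := hsub
    -- the actual diameter
    obtain ⟨⟨p', q'⟩, hpq', hmax⟩ := Finset.exists_max_image (Z ×ˢ Z)
      (fun z : X × X => dist z.1 z.2) ⟨(p, q), by simp [hp, hq]⟩
    simp only [Finset.mem_product] at hpq' hmax
    set D := dist p' q' with hDdef
    have hDmax : ∀ x ∈ Z, ∀ y ∈ Z, dist x y ≤ D := fun x hx y hy => hmax (x, y) ⟨hx, hy⟩
    have hD : 0 < D := lt_of_lt_of_le (dist_pos.2 hpq) (hDmax p hp q hq)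
    have hDΔ : D ≤ Δ := hd _ hpq'.1 _ hpq'.2
    have hM' : ∀ x ∈ Z, ∑ y ∈ Z with dist x y ≤ D / 4, w y ≤ m ^ t := by
      intro x hx
      refine le_trans ?_ (hM x hx)
      refine Finset.sum_le_sum_of_subset_of_nonneg ?_ (fun i _ _ => (hw i).le)
      intro y hy
      simp only [Finset.mem_filter] at hy ⊢
      exact ⟨hy.1, by linarith [hy.2]⟩
    obtain ⟨u, hu, humax⟩ := Finset.exists_max_image Z
      (fun x => ∑ y ∈ Z with dist x y ≤ D / 8, w y) ⟨p, hp⟩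
    set B : ℕ → Finset X := fun i => {y ∈ Z | dist u y ≤ D / 8 + i * (D / (8 * t))} with hB
    set a : ℕ → ℝ := fun i => ∑ y ∈ B i, w y with ha
    have huB : ∀ i, u ∈ B i := by
      intro i; simp only [hB, Finset.mem_filter, dist_self]; exact ⟨hu, by positivity⟩
    have hapos : ∀ i, 0 < a i := fun i => Finset.sum_pos (fun x _ => hw x) ⟨u, huB i⟩
    set m' : ℝ := a 0 ^ ((t : ℝ)⁻¹) with hm'def
    have hm' : 0 < m' := Real.rpow_pos_of_pos (hapos 0) _
    have hm't : m' ^ t = a 0 := Real.rpow_inv_natCast_pow (hapos 0).le (by omega)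
    have hat : a t ≤ m ^ t := by
      refine le_trans (le_of_eq ?_) (hM' u hu)
      have : D / 8 + t * (D / (8 * t)) = D / 4 := by field_simp; norm_num
      simp only [ha, hB, this]
    obtain ⟨i, hit, hi⟩ := aux_pigeon t (by omega) a m m' hm hm' hm't.symm hat
    have hit' : (i : ℝ) + 1 ≤ t := by exact_mod_cast hit
    have hr : D / 8 + i * (D / (8 * t)) ≤ D / 4 := by
      have : D / 8 + t * (D / (8 * t)) = D / 4 := by field_simp; norm_num
      rw [← this]
      gcongr
    have hQZ : B i ⊆ Z := Finset.filter_subset _ _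
    have hPZ : B (i + 1) ⊆ Z := Finset.filter_subset _ _
    have hQd : ∀ x ∈ B i, ∀ y ∈ B i, dist x y ≤ D / 2 := by
      intro x hx y hy
      simp only [hB, Finset.mem_filter] at hx hy
      have := dist_triangle_left x y u
      linarith [hx.2, hy.2]
    have hQcard : (B i).card ≤ n := by
      have : (B i).card < Z.card := by
        refine Finset.card_lt_card ⟨hQZ, fun h => ?_⟩
        have := hQd _ (h hpq'.1) _ (h hpq'.2)
        linarith
      omega
    have hRcard : (Z \ B (i + 1)).card ≤ n := by
      have : (Z \ B (i + 1)).card < Z.card := by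
        refine Finset.card_lt_card ⟨Finset.sdiff_subset, fun h => ?_⟩
        have := h hu
        simp [huB (i + 1)] at this
      omega
    obtain ⟨S₁, hS₁, ρ₁, hρ₁, hw₁⟩ := ih (B i) hQcard (D / 2) m' (by positivity) hm' hQd (by
      intro x hx
      rw [hm't]
      have h0 : a 0 = ∑ y ∈ Z with dist u y ≤ D / 8, w y := by simp [ha, hB]
      rw [h0]
      refine le_trans ?_ (humax x (hQZ hx))
      refine Finset.sum_le_sum_of_subset_of_nonneg ?_ (fun i _ _ => (hw i).le)
      intro y hy
      rw [Finset.mem_filter] at hy ⊢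
      exact ⟨hQZ hy.1, by linarith [hy.2]⟩)
    obtain ⟨S₂, hS₂, ρ₂, hρ₂, hw₂⟩ := ih (Z \ B (i + 1)) hRcard D m hD.le hm
      (fun x hx y hy => hDmax x (Finset.sdiff_subset hx) y (Finset.sdiff_subset hy)) (by
      intro x hx
      refine le_trans ?_ (hM' x (Finset.sdiff_subset hx))
      refine Finset.sum_le_sum_of_subset_of_nonneg ?_ (fun i _ _ => (hw i).le)
      exact Finset.filter_subset_filter _ Finset.sdiff_subset)
    have hsep : ∀ x ∈ S₁, ∀ y ∈ S₂, D / (8 * t) < dist x y := by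
      intro x hx y hy
      have h1 := hS₁ hx
      have h2 := hS₂ hy
      simp only [hB, Finset.mem_filter, Finset.mem_sdiff, not_and, not_le] at h1 h2
      have h3 := h2.2 h2.1
      push_cast at h3
      have := dist_triangle u x y
      linarith [h1.2]
    have hdis : Disjoint S₁ S₂ := by
      rw [Finset.disjoint_left]
      intro x h1 h2
      have := hsep x h1 x h2
      rw [dist_self] at this
      have h4 : 0 < D / (8 * t) := by positivity
      linarith
    obtain ⟨ρ, hρ⟩ := aux_glue t S₁ S₂ ρ₁ ρ₂ D
      ⟨hρ₁.lo, hρ₁.hi, hρ₁.sym, hρ₁.ultra, fun x hx y hy => by linarith [hρ₁.bd x hx y hy]⟩ hρ₂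
      (fun x hx y hy => hDmax x (hQZ (hS₁ hx)) y (Finset.sdiff_subset (hS₂ hy)))
      (fun x hx y hy => by
        have := (hsep x hx y hy).le
        rw [div_le_iff₀ (by positivity)] at this
        linarith) hdis hD.le
    refine ⟨S₁ ∪ S₂, Finset.union_subset (hS₁.trans hQZ) (hS₂.trans Finset.sdiff_subset), ρ,
      ⟨hρ.lo, hρ.hi, hρ.sym, hρ.ultra, fun x hx y hy => (hρ.bd x hx y hy).trans hDΔ⟩, ?_⟩
    rw [Finset.sum_union hdis]
    refine le_trans ?_ (add_le_add hw₁ hw₂)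
    rw [← Finset.sum_sdiff hPZ, add_div, add_comm]
    gcongr ?_ + _
    rw [div_le_div_iff₀ hm hm']
    change a (i + 1) * m' ≤ a i * m
    linarith

/-- weighted metric Ramsey theorem, `χ_UM(8t) ≥ 1 - 1/t`. -/
theorem stmt_2 {X : Type*} [MetricSpace X] [Fintype X]
    (t : ℕ) (ht : 2 ≤ t) (w : X → ℝ) (hw : ∀ x, 0 < w x) :
    ∃ (S : Finset X) (U : Type) (ρ : U → U → ℝ) (f : X → U) (c : ℝ),
      IsUltrametric ρ ∧ 0 < c ∧
      (∀ x ∈ S, ∀ y ∈ S,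
        c * dist x y ≤ ρ (f x) (f y) ∧ ρ (f x) (f y) ≤ c * (8 * t) * dist x y) ∧
      (∑ x : X, w x) ^ (1 - 1 / (t : ℝ)) ≤ ∑ x ∈ S, w x ^ (1 - 1 / (t : ℝ)) := by
  classical
  have ht0 : (0 : ℝ) < t := by exact_mod_cast (by omega : 0 < t)
  rcases isEmpty_or_nonempty X with hX | hX
  · refine ⟨∅, Unit, fun _ _ => 0, fun _ => (), 1, ⟨by simp, by simp, by simp, by simp⟩,
      one_pos, by simp, ?_⟩
    have : (1 - 1 / (t : ℝ)) ≠ 0 := by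
      have : (2 : ℝ) ≤ t := by exact_mod_cast ht
      have : 1 / (t : ℝ) < 1 := by rw [div_lt_one ht0]; linarith
      linarith
    simp only [Finset.univ_eq_empty, Finset.sum_empty]
    rw [Real.zero_rpow this]
  have hW : 0 < ∑ x : X, w x := Finset.sum_pos (fun x _ => hw x) Finset.univ_nonempty
  obtain ⟨S, -, ρ, hρ, hS⟩ := aux_main t ht w hw (Finset.univ : Finset X).card Finset.univ le_rfl
    (Metric.diam (Set.univ : Set X)) ((∑ x : X, w x) ^ ((t : ℝ)⁻¹)) Metric.diam_nonneg
    (Real.rpow_pos_of_pos hW _)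
    (fun x _ y _ => Metric.dist_le_diam_of_mem (Set.finite_univ.isBounded) (Set.mem_univ _)
      (Set.mem_univ _))
    (by
      intro x _
      rw [Real.rpow_inv_natCast_pow hW.le (by omega)]
      exact Finset.sum_le_sum_of_subset_of_nonneg (Finset.filter_subset _ _)
        (fun i _ _ => (hw i).le))
  have hS' : (∑ x : X, w x) ^ (1 - 1 / (t : ℝ)) ≤ ∑ x ∈ S, w x ^ (1 - 1 / (t : ℝ)) := by
    refine le_trans (le_of_eq ?_) hS
    rw [Real.rpow_sub hW, Real.rpow_one, one_div]
  have hne : S.Nonempty := by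
    by_contra h
    rw [Finset.not_nonempty_iff_eq_empty] at h
    subst h
    have := Real.rpow_pos_of_pos hW (1 - 1 / (t : ℝ))
    rw [Finset.sum_empty] at hS'
    linarith
  obtain ⟨s, hs⟩ := hne
  let e := S.equivFin
  have h0 : ∀ x ∈ S, ∀ y ∈ S, (ρ x y = 0 ↔ x = y) := by
    intro x hx y hy
    constructor
    · intro h
      have := hρ.lo x hx y hy
      rw [h] at this
      exact dist_le_zero.1 this
    · rintro rfl
      have h1 := hρ.lo x hx x hx
      have h2 := hρ.hi x hx x hx
      rw [dist_self] at h1 h2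
      linarith
  refine ⟨S, Fin S.card, fun i j => ρ (e.symm i) (e.symm j),
    fun x => if h : x ∈ S then e ⟨x, h⟩ else e ⟨s, hs⟩, 1, ⟨?_, ?_, ?_, ?_⟩, one_pos, ?_, hS'⟩
  · intro i j
    exact dist_nonneg.trans (hρ.lo _ (e.symm i).2 _ (e.symm j).2)
  · intro i j
    rw [h0 _ (e.symm i).2 _ (e.symm j).2]
    simp
  · intro i j
    exact hρ.sym _ (e.symm i).2 _ (e.symm j).2
  · intro i j k
    exact hρ.ultra _ (e.symm i).2 _ (e.symm j).2 _ (e.symm k).2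
  · intro x hx y hy
    simp only [hx, hy, dite_true, Equiv.symm_apply_apply, one_mul]
    exact ⟨hρ.lo x hx y hy, hρ.hi x hx y hy⟩
end

section
/- For every integer t ≥ 2, every n-point metric space contains a subspace of size at least n^{1-1/t} that embeds into an ultrametric space with distortion at most 8t. -/
open Finset

/-- `ρ` is an ultrametric on `S`, bounded by `D`, approximating the metric up to `K`. -/
def RamseyGood {X : Type*} [MetricSpace X] (K : ℝ) (S : Finset X) (ρ : X → X → ℝ) (D : ℝ) : Prop :=
  ∀ x ∈ S, ∀ y ∈ S, dist x y ≤ ρ x y ∧ ρ x y ≤ K * dist x y ∧ ρ x y ≤ D ∧ ρ x y = ρ y x ∧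
    ∀ z ∈ S, ρ x z ≤ max (ρ x y) (ρ y z)

open Classical in
theorem ramsey_glue {X : Type*} [MetricSpace X] (K D : ℝ) (A C : Finset X) (ρ σ : X → X → ℝ)
    (hA : RamseyGood K A ρ D) (hC : RamseyGood K C σ D)
    (hsep : ∀ a ∈ A, ∀ c ∈ C, a ≠ c ∧ dist a c ≤ D ∧ D ≤ K * dist a c) :
    ∃ τ, RamseyGood K (A ∪ C) τ D := by
  have hd : ∀ a ∈ A, a ∉ C := fun a ha hc => (hsep a ha a hc).1 rfl
  have hd' : ∀ a ∈ C, a ∉ A := fun a ha hc => (hsep a hc a ha).1 rfl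
  refine ⟨fun x y => if x ∈ A ∧ y ∈ A then ρ x y else if x ∈ C ∧ y ∈ C then σ x y else D, ?_⟩
  intro x hx y hy
  rw [mem_union] at hx hy
  rcases hx with hx | hx <;> rcases hy with hy | hy
  · obtain ⟨h1, h2, h3, h4, h5⟩ := hA x hx y hy
    simp only [hx, hy, and_self, if_true]
    refine ⟨h1, h2, h3, h4, fun z hz => ?_⟩
    rcases mem_union.1 hz with hz | hz
    · simp [hz, h5 z hz]
    · simp [hd' z hz, hd x hx, hd y hy]
  · obtain ⟨h1, h2, h3⟩ := hsep x hx y hy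
    simp only [hx, hy, hd x hx, hd' y hy, and_false, false_and, if_false]
    refine ⟨h2, h3, le_rfl, trivial, fun z hz => ?_⟩
    rcases mem_union.1 hz with hz | hz
    · simp [hz, (hA x hx z hz).2.2.1]
    · simp [hd' z hz]
  · obtain ⟨h1, h2, h3⟩ := hsep y hy x hx
    simp only [hx, hy, hd' x hx, hd y hy, and_false, false_and, if_false]
    rw [dist_comm]
    refine ⟨h2, h3, le_rfl, trivial, fun z hz => ?_⟩
    rcases mem_union.1 hz with hz | hz
    · simp [hd z hz]
    · simp [hz, (hC x hx z hz).2.2.1]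
  · obtain ⟨h1, h2, h3, h4, h5⟩ := hC x hx y hy
    simp only [hx, hy, hd' x hx, hd' y hy, and_self, if_true, if_false]
    refine ⟨h1, h2, h3, h4, fun z hz => ?_⟩
    rcases mem_union.1 hz with hz | hz
    · simp [hd z hz]
    · simp [hz, h5 z hz]

/-- In a positive sequence of `t` steps some ratio is at most the geometric mean. -/
theorem ramsey_pigeon (t : ℕ) (ht : 2 ≤ t) (b : ℕ → ℝ) (M : ℝ) (hb : 0 < b 0) (hM : 0 < M)
    (hbM : b t ≤ M) : ∃ i < t, b (i + 1) / M ^ (1 / (t : ℝ)) ≤ b i / (b 0) ^ (1 / (t : ℝ)) := by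
  by_contra! hcon
  have ht0 : t ≠ 0 := by omega
  have hp : 0 < M ^ (1 / (t : ℝ)) := Real.rpow_pos_of_pos hM _
  have hq : 0 < (b 0) ^ (1 / (t : ℝ)) := Real.rpow_pos_of_pos hb _
  set p := M ^ (1 / (t : ℝ)) with hpdef
  set q := (b 0) ^ (1 / (t : ℝ)) with hqdef
  have hpt : p ^ t = M := by
    rw [hpdef, one_div]; exact Real.rpow_inv_natCast_pow hM.le ht0
  have hqt : q ^ t = b 0 := by
    rw [hqdef, one_div]; exact Real.rpow_inv_natCast_pow hb.le ht0
  have step : ∀ i < t, (p / q) * b i < b (i + 1) := by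
    intro i hi
    have := hcon i hi
    rw [lt_div_iff₀ hp] at this
    calc (p / q) * b i = b i / q * p := by ring
      _ < _ := this
  have hr : 0 < p / q := div_pos hp hq
  have key : ∀ i ≤ t, (p / q) ^ i * b 0 ≤ b i := by
    intro i
    induction i with
    | zero => simp
    | succ i ih =>
      intro hi
      have h1 := ih (by omega)
      have h2 := step i (by omega)
      calc (p / q) ^ (i + 1) * b 0 = (p / q) * ((p / q) ^ i * b 0) := by ring
        _ ≤ (p / q) * b i := by gcongr
        _ ≤ _ := h2.le
  obtain ⟨s, rfl⟩ : ∃ s, t = s + 1 := ⟨t - 1, by omega⟩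
  have h1 := key s (by omega)
  have h2 := step s (by omega)
  have h3 : (p / q) ^ (s + 1) * b 0 < b (s + 1) :=
    calc (p / q) ^ (s + 1) * b 0 = (p / q) * ((p / q) ^ s * b 0) := by ring
        _ ≤ (p / q) * b s := by gcongr
        _ < _ := h2
  rw [div_pow, hpt, hqt, div_mul_cancel₀ _ hb.ne'] at h3
  linarith

open Classical in
theorem ramsey_main {X : Type*} [MetricSpace X] (t : ℕ) (ht : 2 ≤ t) :
    ∀ (n : ℕ) (Z : Finset X) (D M : ℝ), Z.card ≤ n → (∀ x ∈ Z, ∀ y ∈ Z, dist x y ≤ D) →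
      (∀ u ∈ Z, ((Z.filter (fun x => dist u x ≤ D / 4)).card : ℝ) ≤ M) →
      ∃ S : Finset X, S ⊆ Z ∧ (Z.card : ℝ) / M ^ (1 / (t : ℝ)) ≤ S.card ∧
        ∃ ρ, RamseyGood (8 * t) S ρ D := by
  intro n
  induction n with
  | zero =>
    intro Z D M hZ _ _
    have : Z = ∅ := by simpa using hZ
    subst this
    exact ⟨∅, by simp, by simp, fun _ _ => 0, by simp [RamseyGood]⟩
  | succ n ih =>
    intro Z D₀ M hZn hD₀ hM₀
    rcases Z.eq_empty_or_nonempty with rfl | hne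
    · exact ⟨∅, by simp, by simp, fun _ _ => 0, by simp [RamseyGood]⟩
    obtain ⟨w, hw, hwmax⟩ := (Z ×ˢ Z).exists_max_image (fun p => dist p.1 p.2)
      (hne.product hne)
    rw [mem_product] at hw
    set D := dist w.1 w.2 with hDdef
    have hD : ∀ x ∈ Z, ∀ y ∈ Z, dist x y ≤ D := fun x hx y hy =>
      hwmax (x, y) (mem_product.2 ⟨hx, hy⟩)
    have hDD : D ≤ D₀ := hD₀ _ hw.1 _ hw.2
    have hD0 : 0 ≤ D := dist_nonneg
    have hM : ∀ u ∈ Z, ((Z.filter (fun x => dist u x ≤ D / 4)).card : ℝ) ≤ M := by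
      intro u hu
      refine le_trans ?_ (hM₀ u hu)
      gcongr
    suffices h : ∃ S : Finset X, S ⊆ Z ∧ (Z.card : ℝ) / M ^ (1 / (t : ℝ)) ≤ S.card ∧
        ∃ ρ, RamseyGood (8 * t) S ρ D by
      obtain ⟨S, h1, h2, ρ, h3⟩ := h
      refine ⟨S, h1, h2, ρ, fun x hx y hy => ?_⟩
      obtain ⟨a, b, c, d⟩ := h3 x hx y hy
      exact ⟨a, b, c.trans hDD, d⟩
    have hM1 : 1 ≤ M := by
      refine le_trans ?_ (hM _ hw.1)
      have : 0 < (Z.filter (fun x => dist w.1 x ≤ D / 4)).card :=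
        card_pos.2 ⟨w.1, mem_filter.2 ⟨hw.1, by rw [dist_self]; linarith⟩⟩
      exact_mod_cast this
    have hMp : 1 ≤ M ^ (1 / (t : ℝ)) := Real.one_le_rpow hM1 (by positivity)
    rcases hD0.eq_or_lt with hDz | hDpos
    · have hs : ∀ x ∈ Z, ∀ y ∈ Z, dist x y = 0 := fun x hx y hy =>
        le_antisymm (hDz ▸ hD x hx y hy) dist_nonneg
      refine ⟨Z, Subset.rfl, div_le_self (Nat.cast_nonneg _) hMp, fun _ _ => 0, ?_⟩
      intro x hx y hy
      simp [hs x hx y hy, hD0]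
    obtain ⟨v, hv, hvmax⟩ := Z.exists_max_image
      (fun u => (Z.filter (fun x => dist u x ≤ D / 8)).card) hne
    have htpos : (0 : ℝ) < t := by positivity
    let r : ℕ → ℝ := fun i => D / 8 + i * (D / (8 * t))
    let B : ℕ → Finset X := fun i => Z.filter (fun x => dist v x ≤ r i)
    have hr0 : r 0 = D / 8 := by simp [r]
    have hrt : r t = D / 4 := by simp only [r]; field_simp; norm_num
    have hrpos : ∀ i, 0 ≤ r i := fun i => by simp only [r]; positivity
    have hrle : ∀ i ≤ t, r i ≤ D / 4 := by
      intro i hi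
      rw [← hrt]; simp only [r]
      gcongr
    have hvB : ∀ i, v ∈ B i := fun i => by simp [B, hv, hrpos i]
    obtain ⟨i, hi, hratio⟩ := ramsey_pigeon t ht (fun i => ((B i).card : ℝ)) M
      (by exact_mod_cast card_pos.2 ⟨v, hvB 0⟩) (by linarith)
      (by simp only [B, hrt]; exact hM v hv)
    have hBZ : ∀ i, B i ⊆ Z := fun i => filter_subset _ _
    have hdiamA : ∀ x ∈ B i, ∀ y ∈ B i, dist x y ≤ D / 2 := by
      intro x hx y hy
      have h1 := (mem_filter.1 hx).2
      have h2 := (mem_filter.1 hy).2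
      have h3 := hrle i hi.le
      have := dist_triangle_left x y v
      linarith
    have hAlt : (B i).card < Z.card := by
      apply card_lt_card
      refine ⟨hBZ i, fun h => ?_⟩
      have := hdiamA _ (h hw.1) _ (h hw.2)
      linarith
    have hClt : (Z \ B (i + 1)).card < Z.card := by
      apply card_lt_card
      exact ⟨sdiff_subset, fun h => (mem_sdiff.1 (h hv)).2 (hvB _)⟩
    obtain ⟨S, hSA, hS, ρ, hρ⟩ := ih (B i) (D / 2) ((B 0).card : ℝ) (by omega) hdiamA (by
      intro u hu
      have h1 := hvmax u (hBZ i hu)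
      have h2 : ((B i).filter (fun x => dist u x ≤ D / 2 / 4)).card ≤
          (Z.filter (fun x => dist u x ≤ D / 8)).card := by
        apply card_le_card
        intro x hx
        rw [mem_filter] at hx ⊢
        exact ⟨hBZ i hx.1, by linarith [hx.2]⟩
      have h3 : (Z.filter (fun x => dist v x ≤ D / 8)).card = (B 0).card := by
        simp only [B, hr0]
      have h4 := h2.trans (h1.trans_eq h3)
      exact_mod_cast h4)
    obtain ⟨T, hTC, hT, σ, hσ⟩ := ih (Z \ B (i + 1)) D M (by omega)
      (fun x hx y hy => hD x (mem_sdiff.1 hx).1 y (mem_sdiff.1 hy).1) (by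
      intro u hu
      refine le_trans ?_ (hM u (mem_sdiff.1 hu).1)
      have h4 : ((Z \ B (i + 1)).filter (fun x => dist u x ≤ D / 4)).card ≤
          (Z.filter (fun x => dist u x ≤ D / 4)).card :=
        card_le_card (filter_subset_filter _ sdiff_subset)
      exact_mod_cast h4)
    have hsep : ∀ a ∈ S, ∀ c ∈ T, a ≠ c ∧ dist a c ≤ D ∧ D ≤ 8 * t * dist a c := by
      intro a ha c hc
      have ha1 := mem_filter.1 (hSA ha)
      have hc1 := mem_sdiff.1 (hTC hc)
      have hc2 : r (i + 1) < dist v c := by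
        by_contra! h
        exact hc1.2 (mem_filter.2 ⟨hc1.1, h⟩)
      have h1 := dist_triangle v a c
      have h2 : r (i + 1) = r i + D / (8 * t) := by simp only [r]; push_cast; ring
      have h3 : D / (8 * t) < dist a c := by linarith [ha1.2]
      have h4 : 0 < D / (8 * t) := by positivity
      refine ⟨dist_pos.1 (h4.trans h3), hD a ha1.1 c hc1.1, ?_⟩
      rw [div_lt_iff₀ (by positivity)] at h3
      linarith
    have hρ' : RamseyGood (8 * t) S ρ D := by
      intro x hx y hy
      obtain ⟨a, b, c, d⟩ := hρ x hx y hy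
      exact ⟨a, b, by linarith, d⟩
    obtain ⟨τ, hτ⟩ := ramsey_glue _ D S T ρ σ hρ' hσ hsep
    refine ⟨S ∪ T, union_subset (hSA.trans (hBZ i)) (hTC.trans sdiff_subset), ?_, τ, hτ⟩
    have hdisj : Disjoint S T := disjoint_left.2 fun a ha hc => (hsep a ha a hc).1 rfl
    rw [card_union_of_disjoint hdisj]
    have hcard : (Z.card : ℝ) = (B (i + 1)).card + (Z \ B (i + 1)).card := by
      have := card_sdiff_add_card_eq_card (hBZ (i + 1))
      rw [← this]; push_cast; ring
    rw [hcard, add_div]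
    push_cast
    have := hratio.trans hS
    linarith

/-- unweighted metric Ramsey theorem: every `n`-point metric space has a
subspace of size at least `n^{1-1/t}` embedding into an ultrametric with distortion `8t`. -/
theorem stmt_3 {X : Type*} [MetricSpace X] [Fintype X] (t : ℕ) (ht : 2 ≤ t) :
    ∃ (S : Finset X) (U : Type) (ρ : U → U → ℝ) (f : X → U),
      IsUltrametric ρ ∧
      (Fintype.card X : ℝ) ^ (1 - 1 / (t : ℝ)) ≤ (S.card : ℝ) ∧
      (∀ x ∈ S, ∀ y ∈ S,
        dist x y ≤ ρ (f x) (f y) ∧ ρ (f x) (f y) ≤ (8 * t) * dist x y) := by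
  classical
  have ht2 : (2 : ℝ) ≤ t := by exact_mod_cast ht
  rcases isEmpty_or_nonempty X with hX | hX
  · refine ⟨∅, Empty, fun _ _ => 0, fun x => isEmptyElim x, ?_, ?_, by simp⟩
    · exact ⟨fun x => x.elim, fun x => x.elim, fun x => x.elim, fun x => x.elim⟩
    · have : (1 - 1 / (t : ℝ)) ≠ 0 := by
        have : 1 / (t : ℝ) < 1 := by rw [div_lt_one (by linarith)]; linarith
        linarith
      simp only [Fintype.card_eq_zero, Nat.cast_zero, card_empty]
      rw [Real.zero_rpow this]
  have hn : (0 : ℝ) < Fintype.card X := by exact_mod_cast Fintype.card_pos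
  obtain ⟨D, hD⟩ : ∃ D, ∀ x y : X, dist x y ≤ D := by
    obtain ⟨w, hw⟩ := Finite.exists_max (fun p : X × X => dist p.1 p.2)
    exact ⟨_, fun x y => hw (x, y)⟩
  obtain ⟨S, -, hS, ρ, hρ⟩ := ramsey_main t ht _ (univ : Finset X) D (Fintype.card X) le_rfl
    (fun x _ y _ => hD x y) (fun u _ => by exact_mod_cast card_le_univ _)
  have hS' : (Fintype.card X : ℝ) ^ (1 - 1 / (t : ℝ)) ≤ (S.card : ℝ) := by
    rw [Real.rpow_sub hn, Real.rpow_one]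
    simpa using hS
  have hSne : S.Nonempty := by
    rw [← card_pos]
    have := (Real.rpow_pos_of_pos hn (1 - 1 / (t : ℝ))).trans_le hS'
    exact_mod_cast this
  obtain ⟨s, hs⟩ := hSne
  let e := S.equivFin
  refine ⟨S, Fin S.card, fun i j => ρ (e.symm i) (e.symm j),
    fun x => if h : x ∈ S then e ⟨x, h⟩ else e ⟨s, hs⟩, ⟨?_, ?_, ?_, ?_⟩, hS', ?_⟩
  · intro i j
    exact dist_nonneg.trans (hρ _ (e.symm i).2 _ (e.symm j).2).1
  · intro i j
    obtain ⟨h1, h2, -⟩ := hρ _ (e.symm i).2 _ (e.symm j).2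
    constructor
    · intro h
      have h1 := h1.trans_eq h
      exact e.symm.injective (Subtype.ext (dist_le_zero.1 h1))
    · rintro rfl
      rw [dist_self] at h1 h2
      show ρ (e.symm i) (e.symm i) = 0
      linarith
  · intro i j
    exact (hρ _ (e.symm i).2 _ (e.symm j).2).2.2.2.1
  · intro i j k
    exact (hρ _ (e.symm i).2 _ (e.symm j).2).2.2.2.2 _ (e.symm k).2
  · intro x hx y hy
    obtain ⟨h1, h2, -⟩ := hρ x hx y hy
    simp [hx, hy, h1, h2]
end
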